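/- arXiv:1711.00329 — 3 statements merged into one kernel-verified Lean document; each statement's English description precedes it below -/
import Mathlib

section
/- Let 0 < β′ < β and E ∈ [0, β′]. If the distance from E to the set σ(H̃) is strictly greater than (β′)² ‖HΠ‖² β⁻³, then H − E is invertible; in other words, E ∉ σ(H). -/
noncomputable section

open MeasureTheory
open scoped ComplexOrder

/-- The abstract Feshbach–Schur setup: a densely defined nonnegative self-adjoint operator `H`,
an orthogonal projection `P` (denoted `Π`) with range in the domain of `H`, a bounded operator
`T = HΠ`, and a lower bound `Π⊥ H Π⊥ ≥ 2β Π⊥`. -/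
structure FeshbachSetup (ℋ : Type*) [NormedAddCommGroup ℋ] [InnerProductSpace ℂ ℋ]
    [CompleteSpace ℋ] (β : ℝ) : Type _ where
  H : ℋ →ₗ.[ℂ] ℋ
  dense_dom : Dense (H.domain : Set ℋ)
  selfAdjoint : IsSelfAdjoint H
  nonneg : ∀ u : H.domain, 0 ≤ (inner ℂ (u : ℋ) (H u) : ℂ)
  P : ℋ →L[ℂ] ℋ
  P_idem : P.comp P = P
  P_sa : ContinuousLinearMap.adjoint P = P
  memP : ∀ x : ℋ, P x ∈ H.domain
  T : ℋ →L[ℂ] ℋ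
  T_eq : ∀ x : ℋ, T x = H ⟨P x, memP x⟩
  β_pos : 0 < β
  lower : ∀ u : H.domain,
    ((2 * β * ‖(u : ℋ) - P u‖ ^ 2 : ℝ) : ℂ) ≤
      inner ℂ ((u : ℋ) - P u) (H ⟨(u : ℋ) - P u, H.domain.sub_mem u.2 (memP u)⟩)

namespace FeshbachSetup

variable {ℋ : Type*} [NormedAddCommGroup ℋ] [InnerProductSpace ℂ ℋ] [CompleteSpace ℋ]
variable {β : ℝ} (S : FeshbachSetup ℋ β)

/-- `R` witnesses that `H - E` is a bijection from the domain of `H` onto `ℋ`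
with bounded inverse `R`. -/
def IsInvWitness (E : ℝ) (R : ℋ →L[ℂ] ℋ) : Prop :=
  (∀ u : S.H.domain, R (S.H u - (E : ℂ) • (u : ℋ)) = u) ∧
  (∀ y : ℋ, ∃ h : R y ∈ S.H.domain, S.H ⟨R y, h⟩ - (E : ℂ) • R y = y)

/-- `H - E` is a bijection from the domain of `H` onto `ℋ` with bounded inverse. -/
def IsInvertibleAt (E : ℝ) : Prop := ∃ R, S.IsInvWitness E R

/-- the spectrum `σ(H)` (as a subset of `ℝ`). -/
def spec : Set ℝ := {E | ¬ S.IsInvertibleAt E}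

/-- the bounded operator `Π⊥ H Π`. -/
def A : ℋ →L[ℂ] ℋ := (1 - S.P).comp S.T

/-- `R : ℝ → 𝓛(ℋ)` is the family of reduced resolvents `E ↦ R⊥(E)`:  for `E ∈ [0, 2β)`,
`R E` is supported on `Π⊥ℋ` and is there a two-sided inverse of `Π⊥(H - E)Π⊥`. -/
def IsRedResolvent (R : ℝ → (ℋ →L[ℂ] ℋ)) : Prop :=
  ∀ E ∈ Set.Ico (0 : ℝ) (2 * β),
    ((1 - S.P).comp ((R E).comp (1 - S.P)) = R E) ∧
    (∀ u : S.H.domain,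
      R E ((1 - S.P)
          (S.H ⟨(u : ℋ) - S.P u, S.H.domain.sub_mem u.2 (S.memP u)⟩
            - (E : ℂ) • ((u : ℋ) - S.P u)))
        = (u : ℋ) - S.P u) ∧
    (∀ y : ℋ, ∃ h : R E y ∈ S.H.domain,
      (1 - S.P) (S.H ⟨R E y, h⟩ - (E : ℂ) • R E y) = (1 - S.P) y)

/-- `Y = Π + ΠHΠ⊥ R⊥(0)² Π⊥HΠ`, as an operator on `ℋ` vanishing on `Π⊥ℋ`. -/
def Y (R : ℝ → (ℋ →L[ℂ] ℋ)) : ℋ →L[ℂ] ℋ :=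
  S.P + (ContinuousLinearMap.adjoint S.A).comp ((R 0).comp ((R 0).comp S.A))

/-- `G` is `Y^{-1/2} ∈ 𝓛(Πℋ)`, extended by `0` on `Π⊥ℋ`:  `G` is supported on `Πℋ`,
self-adjoint, nonnegative, and `G Y G = Π`. -/
def IsYInvSqrt (R : ℝ → (ℋ →L[ℂ] ℋ)) (G : ℋ →L[ℂ] ℋ) : Prop :=
  S.P.comp (G.comp S.P) = G ∧
  ContinuousLinearMap.adjoint G = G ∧
  (∀ x : ℋ, 0 ≤ (inner ℂ x (G x) : ℂ)) ∧
  G.comp ((S.Y R).comp G) = S.P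

/-- the dressed operator `H̃ = Y^{-1/2}[ΠHΠ - ΠHΠ⊥R⊥(0)Π⊥HΠ]Y^{-1/2}`,
extended by `0` on `Π⊥ℋ`. -/
def Htilde (R : ℝ → (ℋ →L[ℂ] ℋ)) (G : ℋ →L[ℂ] ℋ) : ℋ →L[ℂ] ℋ :=
  G.comp (((S.P.comp S.T) - (ContinuousLinearMap.adjoint S.A).comp ((R 0).comp S.A)).comp G)

end FeshbachSetup

/-- `V` is a two-sided inverse of `W` in the corner algebra `Π 𝓛(ℋ) Π` (with unit `P`),
i.e. `W` viewed as an operator on `Πℋ` is invertible with inverse `V`. -/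
def IsCornerInv {ℋ : Type*} [NormedAddCommGroup ℋ] [InnerProductSpace ℂ ℋ]
    (P W V : ℋ →L[ℂ] ℋ) : Prop :=
  P.comp (V.comp P) = V ∧ V.comp W = P ∧ W.comp V = P

/-- the spectrum of an operator `W` supported on `Πℋ`, viewed as a bounded operator
on `Πℋ` (as a subset of `ℝ`). -/
def cornerSpec {ℋ : Type*} [NormedAddCommGroup ℋ] [InnerProductSpace ℂ ℋ]
    (P W : ℋ →L[ℂ] ℋ) : Set ℝ :=
  {E : ℝ | ¬ ∃ V, IsCornerInv P (W - (E : ℂ) • P) V}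

theorem core {ℋ : Type*} [NormedAddCommGroup ℋ]
    [InnerProductSpace ℂ ℋ] [CompleteSpace ℋ] (P W N : ℋ →L[ℂ] ℋ) (E : ℝ)
    (hP : P * P = P) (hPs : star P = P) (hW : star W = W) (hPW : P * W = W) (hWP : W * P = W)
    (hPN : P * N = N) (hNP : N * P = N)
    (hN : ‖N‖ < Metric.infDist E (cornerSpec P W)) :
    ∃ V, P * V * P = V ∧ (W - (E:ℂ) • P - N) * V = P := by
  set d := Metric.infDist E (cornerSpec P W) with hd
  have hd0 : 0 < d := (norm_nonneg _).trans_lt hN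
  set a : ℋ →L[ℂ] ℋ := W - (E:ℂ) • P + (d:ℂ) • (1 - P) with ha
  have hsa : IsSelfAdjoint a := by
    simp [IsSelfAdjoint, ha, star_smul, hPs, hW]
  have hspec : ∀ x ∈ spectrum ℝ a, d ≤ |x| := by
    intro x hx
    by_contra! hlt
    apply hx
    have h1 : E + x ∉ cornerSpec P W := by
      apply Metric.notMem_of_dist_lt_infDist (x := E)
      simpa [Real.dist_eq] using hlt
    simp only [cornerSpec, Set.mem_ofPred_eq, not_not] at h1
    obtain ⟨V, hV1, hV2, hV3⟩ := h1
    simp only [← ContinuousLinearMap.mul_def] at hV1 hV2 hV3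
    have hne : (d:ℂ) - x ≠ 0 := by
      rw [← Complex.ofReal_sub, Complex.ofReal_ne_zero]
      have := (abs_lt.1 hlt).2
      linarith
    have hPV : P * V = V := by rw [← hV1, ← mul_assoc, hP]
    have hVP : V * P = V := by rw [← hV1, mul_assoc, mul_assoc, hP]
    have e : algebraMap ℝ (ℋ →L[ℂ] ℋ) x - a = -((W - ((E + x : ℝ):ℂ) • P) + ((d:ℂ) - x) • (1 - P)) := by
      have : algebraMap ℝ (ℋ →L[ℂ] ℋ) x = (x:ℂ) • (1 : ℋ →L[ℂ] ℋ) := by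
        ext v; simp [Algebra.algebraMap_eq_smul_one]
      rw [this, ha]
      push_cast
      module
    rw [spectrum.mem_resolventSet_iff, e]
    refine IsUnit.neg ?_
    set X := (W - ((E + x : ℝ):ℂ) • P)
    have hXP : X * P = X := by simp [X, sub_mul, hWP, hP]
    have hPX : P * X = X := by simp [X, mul_sub, hPW, hP]
    refine ⟨⟨_, V + ((d:ℂ) - x)⁻¹ • (1 - P), ?_, ?_⟩, rfl⟩
    · simp [add_mul, mul_add, mul_sub, sub_mul, hV3, hV2, hXP, hPX, hPV, hVP, hP, smul_smul, hne]
    · simp [add_mul, mul_add, mul_sub, sub_mul, hV3, hV2, hXP, hPX, hPV, hVP, hP, smul_smul, hne]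
  have hne : ∀ x ∈ spectrum ℝ a, x ≠ 0 := fun x hx h => by
    have := hspec x hx; simp [h] at this; linarith
  have hcont : ContinuousOn (fun x : ℝ => x⁻¹) (spectrum ℝ a) :=
    continuousOn_inv₀.mono (fun x hx => hne x hx)
  set b := cfc (fun x : ℝ => x⁻¹) a with hb
  have hab : a * b = 1 := by
    have h1 := cfc_mul (fun x : ℝ => x) (fun x : ℝ => x⁻¹) a continuousOn_id hcont
    rw [cfc_id' ℝ a] at h1
    rw [hb, ← h1, ← cfc_const_one ℝ a]
    exact cfc_congr fun x hx => mul_inv_cancel₀ (hne x hx)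
  have hbn : ‖b‖ ≤ d⁻¹ := by
    apply norm_cfc_le (by positivity)
    intro x hx
    rw [norm_inv]
    exact inv_anti₀ hd0 (hspec x hx)
  have hu : IsUnit (1 - b * N) := by
    apply isUnit_one_sub_of_norm_lt_one
    calc ‖b * N‖ ≤ ‖b‖ * ‖N‖ := norm_mul_le _ _
      _ ≤ d⁻¹ * ‖N‖ := by gcongr
      _ < d⁻¹ * d := by gcongr
      _ = 1 := inv_mul_cancel₀ hd0.ne'
  obtain ⟨u, hu⟩ := hu
  have hM : (a - N) * (↑u⁻¹ * b) = 1 := by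
    have : a - N = a * u := by rw [hu, mul_sub, ← mul_assoc, hab]; simp
    rw [this, mul_assoc, ← mul_assoc (u : ℋ →L[ℂ] ℋ), Units.mul_inv, one_mul, hab]
  set U := ↑u⁻¹ * b
  have hPM : W - (E:ℂ) • P - N = P * (a - N) := by
    simp [ha, mul_add, mul_sub, hP, hPW, hPN]
  have hMP : (W - (E:ℂ) • P - N) * P = W - (E:ℂ) • P - N := by
    simp [sub_mul, hP, hWP, hNP]
  refine ⟨P * U * P, ?_, ?_⟩
  · simp only [mul_assoc, hP]; simp only [← mul_assoc, hP]
  · rw [← mul_assoc, ← mul_assoc, hMP, hPM, mul_assoc P, hM, mul_one, hP]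

namespace FeshbachSetup

variable {ℋ : Type*} [NormedAddCommGroup ℋ] [InnerProductSpace ℂ ℋ] [CompleteSpace ℋ]
variable {β : ℝ} (S : FeshbachSetup ℋ β)

theorem symmH (u v : S.H.domain) : inner ℂ (S.H u) (v : ℋ) = inner ℂ (u : ℋ) (S.H v) := by
  have h := LinearPMap.adjoint_isFormalAdjoint (T := S.H) S.dense_dom
  rw [LinearPMap.isSelfAdjoint_def.1 S.selfAdjoint] at h
  exact h u v

theorem PP (x : ℋ) : S.P (S.P x) = S.P x := congrArg (fun f => f x) S.P_idem

theorem P_symm (x y : ℋ) : inner ℂ (S.P x) y = inner ℂ x (S.P y) := by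
  conv_lhs => rw [← S.P_sa]
  exact ContinuousLinearMap.adjoint_inner_left _ _ _

theorem TP (x : ℋ) : S.T (S.P x) = S.T x := by
  rw [S.T_eq, S.T_eq]; congr 1; exact Subtype.ext (S.PP x)

theorem normQ : ‖1 - S.P‖ ≤ 1 := by
  apply IsStarProjection.norm_le
  apply IsStarProjection.one_sub
  exact ⟨S.P_idem, S.P_sa⟩

theorem normP : ‖S.P‖ ≤ 1 := IsStarProjection.norm_le _ ⟨S.P_idem, S.P_sa⟩

theorem normA : ‖S.A‖ ≤ ‖S.T‖ := by
  unfold A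
  calc _ ≤ ‖1 - S.P‖ * ‖S.T‖ := ContinuousLinearMap.opNorm_comp_le _ _
    _ ≤ 1 * ‖S.T‖ := by gcongr; exact S.normQ
    _ = _ := one_mul _

theorem PT_adj : star (S.P * S.T) = S.P * S.T := by
  symm
  rw [ContinuousLinearMap.star_eq_adjoint, ContinuousLinearMap.eq_adjoint_iff]
  intro x y
  have h := S.symmH ⟨S.P x, S.memP x⟩ ⟨S.P y, S.memP y⟩
  simp only [← S.T_eq] at h
  simp only [mul_apply_eq_comp]
  rw [S.P_symm, h, S.P_symm]

variable {R : ℝ → (ℋ →L[ℂ] ℋ)} (hR : S.IsRedResolvent R)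
include hR

theorem PR {E : ℝ} (hE : E ∈ Set.Ico (0 : ℝ) (2 * β)) (x : ℋ) : S.P (R E x) = 0 := by
  rw [← (hR E hE).1]; simp [S.PP]

theorem RP {E : ℝ} (hE : E ∈ Set.Ico (0 : ℝ) (2 * β)) (x : ℋ) : R E (S.P x) = 0 := by
  rw [← (hR E hE).1]; simp [S.PP]

theorem memR {E : ℝ} (hE : E ∈ Set.Ico (0 : ℝ) (2 * β)) (x : ℋ) : R E x ∈ S.H.domain :=
  ((hR E hE).2.2 x).1

theorem HR {E : ℝ} (hE : E ∈ Set.Ico (0 : ℝ) (2 * β)) (x : ℋ) :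
    S.H ⟨R E x, S.memR hR hE x⟩ - S.P (S.H ⟨R E x, S.memR hR hE x⟩)
      = x - S.P x + (E : ℂ) • R E x := by
  obtain ⟨h, h2⟩ := (hR E hE).2.2 x
  have := S.PR hR hE x
  simp [this, -Complex.coe_smul] at h2
  rw [← h2]; abel

/-- the inner product with something orthogonal to the range of `P` -/
theorem inner_HR {E : ℝ} (hE : E ∈ Set.Ico (0 : ℝ) (2 * β)) (x v : ℋ) (hv : S.P v = 0) :
    inner ℂ v (S.H ⟨R E x, S.memR hR hE x⟩) = inner ℂ v x + (E : ℂ) * inner ℂ v (R E x) := by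
  have h := congrArg (fun w => inner ℂ v w) (S.HR hR hE x)
  simp only [inner_sub_right, inner_add_right, ← S.P_symm, hv, inner_zero_left, sub_zero,
    inner_smul_right] at h
  exact h

theorem R_symm {E : ℝ} (hE : E ∈ Set.Ico (0 : ℝ) (2 * β)) (x y : ℋ) :
    inner ℂ (R E x) y = inner ℂ x (R E y) := by
  have h1 := S.inner_HR hR hE y (R E x) (S.PR hR hE x)
  have h2 := S.inner_HR hR hE x (R E y) (S.PR hR hE y)
  have h3 := S.symmH ⟨R E x, S.memR hR hE x⟩ ⟨R E y, S.memR hR hE y⟩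
  have h4 := congrArg (starRingEnd ℂ) h2
  simp only [map_add, map_mul, inner_conj_symm, Complex.conj_ofReal] at h4
  simp only at h3
  rw [h4, h1] at h3
  exact (add_right_cancel h3).symm

theorem R_adj {E : ℝ} (hE : E ∈ Set.Ico (0 : ℝ) (2 * β)) :
    ContinuousLinearMap.adjoint (R E) = R E := by
  symm
  rw [ContinuousLinearMap.eq_adjoint_iff]
  exact S.R_symm hR hE

theorem normR {E : ℝ} (hE : E ∈ Set.Ico (0 : ℝ) (2 * β)) : ‖R E‖ ≤ (2 * β - E)⁻¹ := by
  have hpos : 0 < 2 * β - E := by linarith [hE.2]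
  apply ContinuousLinearMap.opNorm_le_bound _ (by positivity)
  intro x
  have hP := S.PR hR hE x
  have h1 := S.lower ⟨R E x, S.memR hR hE x⟩
  simp only [hP, sub_zero] at h1
  rw [S.inner_HR hR hE x _ hP] at h1
  have h2 := (Complex.le_def.1 h1).1
  rw [inner_self_eq_norm_sq_to_K] at h2
  have h3 : ((E:ℂ) * ((‖R E x‖:ℂ))^2).re = E * ‖R E x‖ ^ 2 := by
    norm_cast
  have h5 := Complex.re_le_norm (inner ℂ (R E x) x)
  have h6 := norm_inner_le_norm (𝕜 := ℂ) (R E x) x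
  rw [Complex.add_re] at h2
  erw [h3] at h2
  rw [Complex.ofReal_re] at h2
  rw [inv_mul_eq_div, le_div_iff₀ hpos]
  rcases (norm_nonneg (R E x)).eq_or_lt with h0 | h0
  · rw [← h0]; simp
  · apply le_of_mul_le_mul_left _ h0
    nlinarith

theorem res_identity {E : ℝ} (hE : E ∈ Set.Ico (0 : ℝ) (2 * β)) :
    R E = R 0 + (E : ℂ) • (R 0 * R 0) + ((E : ℂ) ^ 2) • (R 0 * R E * R 0) := by
  have h0 : (0:ℝ) ∈ Set.Ico (0 : ℝ) (2 * β) := ⟨le_rfl, by linarith [S.β_pos]⟩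
  have e1 : ∀ y, R E y = R 0 y + (E : ℂ) • R E (R 0 y) := by
    intro y
    have h := (hR E hE).2.1 ⟨R 0 y, S.memR hR h0 y⟩
    simp only [S.PR hR h0, sub_zero] at h
    have h2 := S.HR hR h0 y
    have h3 : (1 - S.P) (S.H ⟨R 0 y, S.memR hR h0 y⟩ - (E:ℂ) • R 0 y) = y - S.P y - (E:ℂ) • R 0 y := by
      simp [S.PR hR h0, -Complex.coe_smul] at h2 ⊢
      rw [← h2]; abel
    rw [h3] at h
    simp [S.RP hR hE, -Complex.coe_smul] at h
    exact sub_eq_iff_eq_add.1 h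
  have e2 : ∀ y, R E y = R 0 y + (E : ℂ) • R 0 (R E y) := by
    intro y
    have h := (hR 0 h0).2.1 ⟨R E y, S.memR hR hE y⟩
    simp only [S.PR hR hE, sub_zero] at h
    have h2 := S.HR hR hE y
    simp at h
    rw [← map_sub, h2] at h
    simp [S.RP hR h0, -Complex.coe_smul] at h
    exact h.symm
  ext y
  rw [e2 y, e1 y]
  simp [smul_smul, pow_two, -Complex.coe_smul]
  abel

/-- `P H R z = A* R z` -/
theorem PHR {E : ℝ} (hE : E ∈ Set.Ico (0 : ℝ) (2 * β)) (z : ℋ) :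
    S.P (S.H ⟨R E z, S.memR hR hE z⟩) = ContinuousLinearMap.adjoint S.A (R E z) := by
  apply ext_inner_left ℂ
  intro w
  rw [ContinuousLinearMap.adjoint_inner_right, ← S.P_symm]
  have := S.symmH ⟨S.P w, S.memP w⟩ ⟨R E z, S.memR hR hE z⟩
  simp only at this
  rw [← this, ← S.T_eq]
  simp [A, inner_sub_left, S.P_symm, S.PR hR hE]

/-- Feshbach-Schur: a right inverse of the Schur complement gives invertibility. -/
theorem feshbach {E : ℝ} (hE : E ∈ Set.Ico (0 : ℝ) (2 * β)) (f : ℋ →L[ℂ] ℋ)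
    (hPf : S.P * f = f)
    (hf : (S.P * S.T - (E : ℂ) • S.P - ContinuousLinearMap.adjoint S.A * R E * S.A) * f = S.P) :
    S.IsInvertibleAt E := by
  set As := ContinuousLinearMap.adjoint S.A with hAs
  have hPAs : ∀ x, S.P (As x) = As x := by
    intro x
    apply ext_inner_left ℂ
    intro w
    rw [← S.P_symm, hAs, ContinuousLinearMap.adjoint_inner_right,
      ContinuousLinearMap.adjoint_inner_right]
    simp [A, S.TP]
  have key : ∀ y : ℋ, ∃ h : ((1 - R E * S.A) * f * (S.P - As * R E) + R E) y ∈ S.H.domain,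
      S.H ⟨_, h⟩ - (E : ℂ) • ((1 - R E * S.A) * f * (S.P - As * R E) + R E) y = y := by
    intro y
    set q := S.P y - As (R E y) with hq
    set p := f q with hp
    have hPp : S.P p = p := congrArg (fun g => g q) hPf
    have hFp := congrArg (fun g => g q) hf
    simp only [mul_apply_eq_comp, sub_apply,
      smul_apply, ← hp, hPp] at hFp
    set z := y - S.A p with hz
    have hx : ((1 - R E * S.A) * f * (S.P - As * R E) + R E) y = S.P p + R E z := by
      simp only [mul_apply_eq_comp, sub_apply,
        add_apply, one_apply_eq_self, ← hq, ← hp, hPp, hz, map_sub]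
      abel
    have hmem : S.P p + R E z ∈ S.H.domain := S.H.domain.add_mem (S.memP p) (S.memR hR hE z)
    have hval : S.H ⟨S.P p + R E z, hmem⟩ = S.T p + S.H ⟨R E z, S.memR hR hE z⟩ := by
      rw [S.T_eq, ← LinearPMap.map_add]; rfl
    have h1 := S.HR hR hE z
    rw [S.PHR hR hE z, ← hAs] at h1
    have hfin : S.H ⟨S.P p + R E z, hmem⟩ - (E : ℂ) • (S.P p + R E z) = y := by
      rw [hval, sub_eq_iff_eq_add.1 h1, hPp]
      have hPz : S.P z = S.P y := by simp [hz, A, S.PP]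
      have hPq : S.P q = q := by simp [hq, S.PP, hPAs]
      rw [hPz]
      have hAp : S.A p = S.T p - S.P (S.T p) := by simp [A]
      rw [hPq, hq] at hFp
      have : As (R E z) = As (R E y) - As (R E (S.A p)) := by simp [hz]
      rw [this]
      have h3 : S.P (S.T p) = S.P y - As (R E y) + (E:ℂ) • p + As (R E (S.A p)) := by
        rw [← hFp]; abel
      have h4 : S.T p = S.A p + S.P (S.T p) := by rw [hAp]; abel
      rw [h4, h3, hz, smul_add]
      abel
    have haux : ∀ x : ℋ, x = S.P p + R E z →
        ∃ h : x ∈ S.H.domain, S.H ⟨x, h⟩ - (E : ℂ) • x = y := by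
      rintro x rfl
      exact ⟨hmem, hfin⟩
    exact haux _ hx
  refine ⟨(1 - R E * S.A) * f * (S.P - As * R E) + R E, ?_, key⟩
  intro u
  set X := (1 - R E * S.A) * f * (S.P - As * R E) + R E
  obtain ⟨h, h1⟩ := key (S.H u - (E : ℂ) • (u : ℋ))
  set v : S.H.domain := ⟨X (S.H u - (E : ℂ) • (u : ℋ)), h⟩ with hv
  have hvu : S.H (v - u) - (E : ℂ) • ((v - u : S.H.domain) : ℋ) = 0 := by
    have h2 : S.H v - (E : ℂ) • (v : ℋ) = S.H u - (E : ℂ) • (u : ℋ) := h1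
    rw [LinearPMap.map_sub, Submodule.coe_sub, smul_sub, sub_sub_sub_comm, h2, sub_self]
  set w := v - u with hw
  obtain ⟨h', h3⟩ := key (w : ℋ)
  have h4 := S.symmH w ⟨X (w : ℋ), h'⟩
  have h5 : inner ℂ (w : ℋ) (w : ℋ) = 0 := by
    nth_rewrite 2 [← h3]
    rw [inner_sub_right, ← h4, sub_eq_zero.1 hvu, inner_smul_left, inner_smul_right]
    simp
  have h6 := inner_self_eq_zero.1 h5
  rw [hw, Submodule.coe_sub, sub_eq_zero] at h6
  exact h6

theorem Y_lower (v : ℋ) : ‖S.P v‖ ^ 2 ≤ (inner ℂ v (S.Y R v)).re := by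
  have h0 : (0:ℝ) ∈ Set.Ico (0 : ℝ) (2 * β) := ⟨le_rfl, by linarith [S.β_pos]⟩
  have h1 : inner ℂ v (S.P v) = ((‖S.P v‖ ^ 2 : ℝ) : ℂ) := by
    rw [← S.PP, ← S.P_symm, inner_self_eq_norm_sq_to_K]; simp [S.PP]
  have h2 : inner ℂ v (ContinuousLinearMap.adjoint S.A (R 0 (R 0 (S.A v))))
      = ((‖R 0 (S.A v)‖ ^ 2 : ℝ) : ℂ) := by
    rw [ContinuousLinearMap.adjoint_inner_right, ← S.R_symm hR h0, inner_self_eq_norm_sq_to_K]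
    simp
  have h3 : inner ℂ v (S.Y R v) = ((‖S.P v‖ ^ 2 + ‖R 0 (S.A v)‖ ^ 2 : ℝ) : ℂ) := by
    rw [Complex.ofReal_add, ← h1, ← h2, ← inner_add_right]; rfl
  rw [h3, Complex.ofReal_re]
  nlinarith [sq_nonneg ‖R 0 (S.A v)‖]

theorem normG {G : ℋ →L[ℂ] ℋ} (hG : S.IsYInvSqrt R G) : ‖G‖ ≤ 1 := by
  obtain ⟨g1, g2, -, g4⟩ := hG
  apply ContinuousLinearMap.opNorm_le_bound _ zero_le_one
  intro x
  have hPG : S.P (G x) = G x := by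
    rw [← g1]; simp [S.PP]
  have h1 := S.Y_lower hR (G x)
  have h2 : inner ℂ (G x) (S.Y R (G x)) = inner ℂ x (S.P x) := by
    rw [← g4]
    conv_lhs => rw [← g2]
    rw [ContinuousLinearMap.adjoint_inner_left, g2]
    rfl
  rw [hPG, h2] at h1
  have h3 := Complex.re_le_norm (inner ℂ x (S.P x))
  have h4 := norm_inner_le_norm (𝕜 := ℂ) x (S.P x)
  have h5 : ‖S.P x‖ ≤ ‖x‖ := by
    simpa using S.P.le_of_opNorm_le S.normP x
  rw [one_mul]
  apply (sq_le_sq₀ (norm_nonneg _) (norm_nonneg _)).1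
  nlinarith [norm_nonneg x]

end FeshbachSetup


/-- Let `0 < β' < β` and `E ∈ [0, β']`.  If the distance from `E` to `σ(H̃)` is strictly
greater than `(β')² ‖HΠ‖² β⁻³`, then `H - E` is invertible, i.e. `E ∉ σ(H)`. -/
theorem not_mem_spec_of_infDist_lt {ℋ : Type*} [NormedAddCommGroup ℋ]
    [InnerProductSpace ℂ ℋ] [CompleteSpace ℋ] {β : ℝ} (S : FeshbachSetup ℋ β)
    (R : ℝ → (ℋ →L[ℂ] ℋ)) (hR : S.IsRedResolvent R)
    (G : ℋ →L[ℂ] ℋ) (hG : S.IsYInvSqrt R G)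
    {β' E : ℝ} (hβ'0 : 0 < β') (hβ' : β' < β) (hE : E ∈ Set.Icc 0 β')
    (hdist : β' ^ 2 * ‖S.T‖ ^ 2 * (β ^ 3)⁻¹ <
      Metric.infDist E (cornerSpec S.P (S.Htilde R G))) :
    E ∉ S.spec := by
  have hβ := S.β_pos
  obtain ⟨hE0, hE1⟩ := hE
  have h0 : (0:ℝ) ∈ Set.Ico (0 : ℝ) (2 * β) := ⟨le_rfl, by linarith⟩
  have hEI : E ∈ Set.Ico (0 : ℝ) (2 * β) := ⟨hE0, by linarith⟩
  have hGn := S.normG hR hG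
  obtain ⟨g1, g2, -, g4⟩ := hG
  simp only [← ContinuousLinearMap.mul_def] at g1 g4
  have hP : S.P * S.P = S.P := S.P_idem
  have hPG : S.P * G = G := by rw [← g1, ← mul_assoc, hP]
  have hGP : G * S.P = G := by rw [← g1, mul_assoc, mul_assoc, hP]
  set As := ContinuousLinearMap.adjoint S.A with hAs
  have hAs' : As = star S.A := rfl
  have hR0s : star (R 0) = R 0 := S.R_adj hR h0
  have hGs : star G = G := g2
  have hTP : S.T * S.P = S.T := by ext x; exact S.TP x
  have hAP : S.A * S.P = S.A := by ext x; simp [FeshbachSetup.A, S.TP]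
  have hPAs : S.P * As = As := by
    have := congrArg star hAP
    rw [star_mul, ← hAs'] at this
    rw [← this]
    congr 1
    exact S.P_sa.symm
  set K : ℋ →L[ℂ] ℋ := S.P * S.T - As * (R 0 * S.A) with hK
  have hW : S.Htilde R G = G * (K * G) := rfl
  have hY : S.Y R = S.P + As * (R 0 * (R 0 * S.A)) := rfl
  have hKs : star K = K := by
    rw [hK, star_sub, S.PT_adj, star_mul, star_mul, hR0s, hAs', star_star, mul_assoc]
  set N : ℋ →L[ℂ] ℋ := ((E:ℂ) ^ 2) • (G * (As * (R 0 * (R E * (R 0 * (S.A * G)))))) with hN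
  have hNn : ‖N‖ ≤ β' ^ 2 * ‖S.T‖ ^ 2 * (β ^ 3)⁻¹ := by
    have hAn := S.normA
    have hAsn : ‖As‖ ≤ ‖S.T‖ := by
      rw [hAs', norm_star]; exact hAn
    have hR0n : ‖R 0‖ ≤ β⁻¹ := by
      refine (S.normR hR h0).trans (inv_anti₀ hβ (by linarith))
    have hREn : ‖R E‖ ≤ β⁻¹ := by
      refine (S.normR hR hEI).trans (inv_anti₀ hβ (by linarith))
    have hE2 : ‖((E:ℂ) ^ 2)‖ ≤ β' ^ 2 := by
      rw [norm_pow, Complex.norm_real, Real.norm_of_nonneg hE0]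
      gcongr
    calc ‖N‖ ≤ β' ^ 2 * (1 * (‖S.T‖ * (β⁻¹ * (β⁻¹ * (β⁻¹ * (‖S.T‖ * 1)))))) := by
          rw [hN]
          refine (norm_smul_le _ _).trans ?_
          refine mul_le_mul hE2 ?_ (norm_nonneg _) (by positivity)
          refine norm_mul_le_of_le hGn ?_
          refine norm_mul_le_of_le hAsn ?_
          refine norm_mul_le_of_le hR0n ?_
          refine norm_mul_le_of_le hREn ?_
          refine norm_mul_le_of_le hR0n ?_
          exact norm_mul_le_of_le hAn hGn
      _ = _ := by field_simp
  obtain ⟨V, hV1, hV2⟩ := core S.P (S.Htilde R G) N E hP S.P_sa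
    (by rw [hW, star_mul, star_mul, hGs, hKs, mul_assoc])
    (by rw [hW, ← mul_assoc, hPG]) (by rw [hW, mul_assoc, mul_assoc, hGP])
    (by rw [hN, mul_smul_comm, ← mul_assoc, hPG])
    (by rw [hN, smul_mul_assoc]; simp only [mul_assoc, hGP])
    (hNn.trans_lt hdist)
  set F : ℋ →L[ℂ] ℋ := S.P * S.T - (E : ℂ) • S.P - As * R E * S.A with hF
  have hPF : S.P * F = F := by
    simp only [hF, mul_sub, mul_smul_comm, ← mul_assoc, hP, hPAs]
  have hFK : F = K - (E:ℂ) • S.Y R - ((E:ℂ)^2) • (As * (R 0 * (R E * (R 0 * S.A)))) := by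
    rw [hF, hK, hY]
    conv_lhs => rw [S.res_identity hR hEI]
    simp only [mul_add, add_mul, mul_smul_comm, smul_mul_assoc, smul_add, mul_assoc]
    abel
  have hGFG : G * F * G = S.Htilde R G - (E:ℂ) • S.P - N := by
    rw [hFK, hW, hN, ← g4]
    simp only [mul_sub, sub_mul, mul_smul_comm, smul_mul_assoc, mul_assoc]
  rw [← hGFG] at hV2
  have hfin : F * (G * V * G) = S.P := by
    have h1 : G * (F * (G * V * G)) = G := by
      calc _ = (G * F * G * V) * G := by simp only [mul_assoc]
        _ = G := by rw [hV2, hPG]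
    have h2 : G * (S.Y R * G) * (F * (G * V * G)) = G * (S.Y R * G) := by
      calc _ = G * (S.Y R * (G * (F * (G * V * G)))) := by simp only [mul_assoc]
        _ = _ := by rw [h1]
    rw [g4, ← mul_assoc, hPF] at h2
    exact h2
  have hinv : S.IsInvertibleAt E :=
    S.feshbach hR hEI (G * V * G) (by rw [← mul_assoc, ← mul_assoc, hPG]) hfin
  exact fun h => h hinv
end
end

section
/- For every E ∈ [0, 2β), the operator Π⊥(H − E)Π⊥, viewed as an operator on the subspace Π⊥ℋ, is bijective with bounded inverse R⊥(E) ∈ 𝓛(Π⊥ℋ); moreover, for every E ∈ [0, β] one has the bound ‖R⊥(E)‖ ≤ β⁻¹. -/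
noncomputable section

open MeasureTheory
open scoped ComplexOrder

theorem rr_key {ℋ : Type*} [NormedAddCommGroup ℋ] [InnerProductSpace ℂ ℋ] [CompleteSpace ℋ]
    (H : ℋ →ₗ.[ℂ] ℋ) (hH : IsSelfAdjoint H) (C : ℋ →L[ℂ] ℋ) (δ : ℝ) (hδ : 0 < δ)
    (hlow : ∀ u : H.domain, δ * ‖(u : ℋ)‖ ^ 2 ≤ (inner ℂ (u : ℋ) (H u + C u) : ℂ).re) :
    ∃ R : ℋ →L[ℂ] ℋ, (∀ y, ‖R y‖ ≤ δ⁻¹ * ‖y‖) ∧ (∀ u : H.domain, R (H u + C u) = u) ∧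
      ∀ y, ∃ h : R y ∈ H.domain, H ⟨R y, h⟩ + C (R y) = y := by
  let f : H.domain →ₗ[ℂ] ℋ := H.toFun + (C : ℋ →ₗ[ℂ] ℋ).comp H.domain.subtype
  have hf : ∀ u : H.domain, f u = H u + C u := fun u => rfl
  have hb : ∀ u : H.domain, ‖(u : ℋ)‖ ≤ δ⁻¹ * ‖f u‖ := by
    intro u
    have h1 := hlow u
    rw [← hf] at h1
    have h2 : (inner ℂ (u : ℋ) (f u) : ℂ).re ≤ ‖(u : ℋ)‖ * ‖f u‖ :=
      (Complex.re_le_norm _).trans (norm_inner_le_norm _ _)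
    rw [← div_eq_inv_mul, le_div_iff₀ hδ]
    rcases (norm_nonneg (u : ℋ)).eq_or_lt with h0 | h0
    · rw [← h0]; simp
    · nlinarith
  have hinj : Function.Injective f := by
    rw [← LinearMap.ker_eq_bot, LinearMap.ker_eq_bot']
    intro u hu
    have := hb u
    rw [hu, norm_zero, mul_zero] at this
    exact Subtype.ext (norm_le_zero_iff.1 this)
  have hclosed : IsClosed (LinearMap.range f : Set ℋ) := by
    let G : Set (ℋ × ℋ) := (fun p : ℋ × ℋ => (p.1, p.2 - C p.1)) ⁻¹' (H.graph : Set (ℋ × ℋ))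
    have hG : IsClosed G := by
      have : IsClosed (H.graph : Set (ℋ × ℋ)) := hH.isClosed
      exact this.preimage (by fun_prop)
    have hGm : ∀ p : ℋ × ℋ, p ∈ G ↔ ∃ u : H.domain, (u : ℋ) = p.1 ∧ f u = p.2 := by
      intro p
      change (p.1, p.2 - C p.1) ∈ H.graph ↔ _
      rw [LinearPMap.mem_graph_iff]
      constructor
      · rintro ⟨u, h1, h2⟩
        refine ⟨u, h1, ?_⟩
        rw [hf, h2, h1]; simp
      · rintro ⟨u, h1, h2⟩
        refine ⟨u, h1, ?_⟩
        rw [← h2, ← h1, hf]; simp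
    have : CompleteSpace G := hG.completeSpace_coe
    have hal : AntilipschitzWith (max 1 (Real.toNNReal δ⁻¹)) (fun p : G => (p : ℋ × ℋ).2) := by
      refine AntilipschitzWith.of_le_mul_dist ?_
      rintro ⟨p, hp⟩ ⟨q, hq⟩
      obtain ⟨u, hu1, hu2⟩ := (hGm p).1 hp
      obtain ⟨v, hv1, hv2⟩ := (hGm q).1 hq
      have h := hb (u - v)
      rw [map_sub, hu2, hv2, AddSubgroupClass.coe_sub, hu1, hv1] at h
      have hδ' : (0:ℝ) ≤ δ⁻¹ := by positivity
      rw [Subtype.dist_eq, Prod.dist_eq]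
      simp only [NNReal.coe_max, NNReal.coe_one, Real.coe_toNNReal _ hδ', dist_eq_norm]
      refine max_le (h.trans ?_) ?_
      · gcongr; exact le_max_right _ _
      · exact le_mul_of_one_le_left (norm_nonneg _) (le_max_left _ _)
    have hcl := hal.isClosed_range (f := fun p : G => (p : ℋ × ℋ).2)
      (uniformContinuous_snd.comp uniformContinuous_subtype_val)
    convert hcl using 1
    ext y
    constructor
    · rintro ⟨u, rfl⟩
      exact ⟨⟨((u : ℋ), f u), (hGm _).2 ⟨u, rfl, rfl⟩⟩, rfl⟩
    · rintro ⟨⟨p, hp⟩, rfl⟩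
      obtain ⟨u, _, hu2⟩ := (hGm p).1 hp
      exact ⟨u, hu2⟩
  have hsurj : Function.Surjective f := by
    rw [← LinearMap.range_eq_top]
    have : CompleteSpace (LinearMap.range f) := hclosed.completeSpace_coe
    rw [← Submodule.orthogonal_eq_bot_iff, Submodule.eq_bot_iff]
    intro w hw
    rw [Submodule.mem_orthogonal'] at hw
    have hw' : ∀ u : H.domain, (inner ℂ w (f u) : ℂ) = 0 := fun u => hw _ ⟨u, rfl⟩
    have hmem : w ∈ H.domain := by
      have : w ∈ H.adjoint.domain := by
        refine LinearPMap.mem_adjoint_domain_of_exists _ ⟨- ContinuousLinearMap.adjoint C w, ?_⟩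
        intro x
        have := hw' x
        rw [hf, inner_add_right] at this
        rw [inner_neg_left, ContinuousLinearMap.adjoint_inner_left]
        linear_combination -this
      rwa [LinearPMap.isSelfAdjoint_def.1 hH] at this
    have h1 := hlow ⟨w, hmem⟩
    rw [← hf, hw' ⟨w, hmem⟩] at h1
    have h2 : ‖w‖ ^ 2 ≤ 0 := by
      simp only [Complex.zero_re] at h1
      nlinarith [sq_nonneg ‖w‖]
    exact norm_eq_zero.1 (pow_eq_zero_iff (two_ne_zero) |>.1 (le_antisymm h2 (sq_nonneg _)))
  let e := LinearEquiv.ofBijective f ⟨hinj, hsurj⟩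
  have he : ∀ y, f (e.symm y) = y := fun y => e.apply_symm_apply y
  let R : ℋ →L[ℂ] ℋ := (H.domain.subtype.comp e.symm.toLinearMap).mkContinuous δ⁻¹ (by
    intro y
    have := hb (e.symm y)
    rwa [he] at this)
  have hR : ∀ y, R y = (e.symm y : ℋ) := fun y => rfl
  refine ⟨R, ?_, ?_, ?_⟩
  · intro y
    have := hb (e.symm y)
    rwa [he] at this
  · intro u
    rw [hR, ← hf]
    exact congrArg Subtype.val (e.symm_apply_apply u)
  · intro y
    exact ⟨(e.symm y).2, he y⟩

/-- For every `E ∈ [0, 2β)`, the operator `Π⊥(H - E)Π⊥`, viewed as an operator on `Π⊥ℋ`,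
is bijective with bounded inverse `R⊥(E)`; moreover `‖R⊥(E)‖ ≤ β⁻¹` for `E ∈ [0, β]`. -/
theorem reduced_resolvent_exists {ℋ : Type*} [NormedAddCommGroup ℋ]
    [InnerProductSpace ℂ ℋ] [CompleteSpace ℋ] {β : ℝ} (S : FeshbachSetup ℋ β) :
    ∀ E ∈ Set.Ico (0 : ℝ) (2 * β), ∃ R : ℋ →L[ℂ] ℋ,
      ((1 - S.P).comp (R.comp (1 - S.P)) = R) ∧
      (∀ u : S.H.domain,
        R ((1 - S.P) (S.H ⟨(u : ℋ) - S.P u, S.H.domain.sub_mem u.2 (S.memP u)⟩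
            - (E : ℂ) • ((u : ℋ) - S.P u))) = (u : ℋ) - S.P u) ∧
      (∀ y : ℋ, ∃ h : R y ∈ S.H.domain,
        (1 - S.P) (S.H ⟨R y, h⟩ - (E : ℂ) • R y) = (1 - S.P) y) ∧
      (E ≤ β → ‖R‖ ≤ β⁻¹) := by
  intro E hE
  obtain ⟨hE0, hE2⟩ := hE
  have hPP : ∀ x, S.P (S.P x) = S.P x := fun x => congrArg (fun A : ℋ →L[ℂ] ℋ => A x) S.P_idem
  have hPs : ∀ x y, (inner ℂ (S.P x) y : ℂ) = inner ℂ x (S.P y) := by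
    intro x y
    rw [← ContinuousLinearMap.adjoint_inner_left, S.P_sa]
  have hQ : ∀ x, (1 - S.P) x = x - S.P x := fun x => rfl
  have hsym : ∀ u v : S.H.domain, (inner ℂ (S.H u) (v : ℋ) : ℂ) = inner ℂ (u : ℋ) (S.H v) := by
    have := LinearPMap.adjoint_isFormalAdjoint S.dense_dom
    rw [LinearPMap.isSelfAdjoint_def.1 S.selfAdjoint] at this
    exact this
  have hPH : ∀ u : S.H.domain, S.P (S.H u) = ContinuousLinearMap.adjoint S.T u := by
    intro u
    refine ext_inner_left ℂ fun x => ?_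
    rw [ContinuousLinearMap.adjoint_inner_right, ← hPs, S.T_eq, hsym]
  have hort : ∀ x y, (inner ℂ (S.P x) (y - S.P y) : ℂ) = 0 := by
    intro x y
    rw [hPs, map_sub, hPP, sub_self, inner_zero_right]
  have hnorm : ∀ x, ‖x‖ ^ 2 = ‖S.P x‖ ^ 2 + ‖x - S.P x‖ ^ 2 := by
    intro x
    have := norm_add_sq_eq_norm_sq_add_norm_sq_of_inner_eq_zero (𝕜 := ℂ) _ _ (hort x x)
    rw [add_sub_cancel] at this
    nlinarith
  obtain ⟨δ, hδ⟩ : ∃ δ : ℝ, δ = 2 * β - E := ⟨_, rfl⟩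
  have hδ0 : 0 < δ := by linarith
  let C : ℋ →L[ℂ] ℋ := - ContinuousLinearMap.adjoint S.T - (1 - S.P).comp S.T
    - (E : ℂ) • (1 - S.P) + (δ : ℂ) • S.P
  have hK : ∀ u : S.H.domain, S.H u + C u =
      (1 - S.P) (S.H ⟨(u : ℋ) - S.P u, S.H.domain.sub_mem u.2 (S.memP u)⟩
        - (E : ℂ) • ((u : ℋ) - S.P u)) + (δ : ℂ) • S.P u := by
    intro u
    have h1 : S.H ⟨(u : ℋ) - S.P u, S.H.domain.sub_mem u.2 (S.memP u)⟩ = S.H u - S.T u := by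
      rw [S.T_eq, ← S.H.map_sub]; rfl
    have h2 : C u = - ContinuousLinearMap.adjoint S.T u - (S.T u - S.P (S.T u))
      - (E : ℂ) • ((u : ℋ) - S.P u) + (δ : ℂ) • S.P u := rfl
    rw [h1, h2, hQ, ← hPH]
    simp only [map_sub, map_smul, hPP, sub_self, smul_zero]
    abel
  obtain ⟨R, hRn, hRl, hRr⟩ := rr_key S.H S.selfAdjoint C δ hδ0 (by
    intro u
    have hl := (Complex.le_def.1 (S.lower u)).1
    rw [Complex.ofReal_re] at hl
    rw [hK, hnorm (u : ℋ)]
    generalize S.H ⟨(u : ℋ) - S.P u, S.H.domain.sub_mem u.2 (S.memP u)⟩ = z at hl ⊢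
    have e1 : (inner ℂ (u : ℋ) ((1 - S.P) (z - (E : ℂ) • ((u : ℋ) - S.P u))
        + (δ : ℂ) • S.P u) : ℂ) =
        inner ℂ ((u : ℋ) - S.P u) z - (E : ℂ) * inner ℂ ((u : ℋ) - S.P u) ((u : ℋ) - S.P u)
          + (δ : ℂ) * inner ℂ (S.P u) (S.P u) := by
      have e2 : (inner ℂ (u : ℋ) (S.P u) : ℂ) = inner ℂ (S.P u) (S.P u) := by
        rw [hPs, hPP]
      have e3 : ∀ y : ℋ, (inner ℂ (u : ℋ) ((1 - S.P) y) : ℂ) = inner ℂ ((u : ℋ) - S.P u) y := by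
        intro y
        rw [hQ, inner_sub_right, inner_sub_left, hPs]
      rw [inner_add_right, inner_smul_right, e2, e3, inner_sub_right, inner_smul_right]
    rw [e1, inner_self_eq_norm_sq_to_K, inner_self_eq_norm_sq_to_K]
    have e4 : ∀ a b : ℝ, ((a : ℂ) * (b : ℂ) ^ 2).re = a * b ^ 2 := by
      intro a b
      rw [← Complex.ofReal_pow, ← Complex.ofReal_mul, Complex.ofReal_re]
    have e5 := e4 E ‖(u : ℋ) - S.P u‖
    have e6 := e4 δ ‖S.P (u : ℋ)‖
    rw [Complex.add_re, Complex.sub_re]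
    erw [e5, e6]
    rw [hδ]
    nlinarith)
  have hPQ : ∀ x, S.P ((1 - S.P) x) = 0 := by
    intro x; rw [hQ, map_sub, hPP, sub_self]
  have hQQ : ∀ x, (1 - S.P) ((1 - S.P) x) = (1 - S.P) x := by
    intro x; rw [hQ ((1 - S.P) x), hPQ, sub_zero]
  have hPR : ∀ y, S.P (R ((1 - S.P) y)) = 0 := by
    intro y
    obtain ⟨h, hh⟩ := hRr ((1 - S.P) y)
    have h1 := (hK ⟨_, h⟩).symm.trans hh
    have h2 := congrArg S.P h1
    rw [map_add, hPQ, hPQ, zero_add, map_smul, hPP] at h2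
    exact (smul_eq_zero.1 h2).resolve_left (by exact_mod_cast hδ0.ne')
  refine ⟨R.comp (1 - S.P), ?_, ?_, ?_, ?_⟩
  · ext y
    change (1 - S.P) (R ((1 - S.P) ((1 - S.P) y))) = R ((1 - S.P) y)
    rw [hQQ, hQ (R _), hPR, sub_zero]
  · intro u
    change R ((1 - S.P) ((1 - S.P) _)) = _
    rw [hQQ]
    have h1 := hK ⟨(u : ℋ) - S.P u, S.H.domain.sub_mem u.2 (S.memP u)⟩
    have h0 : S.P ((u : ℋ) - S.P u) = 0 := hPQ u
    simp only [h0, sub_zero, smul_zero, add_zero] at h1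
    rw [← h1]
    exact hRl ⟨(u : ℋ) - S.P u, S.H.domain.sub_mem u.2 (S.memP u)⟩
  · intro y
    obtain ⟨h, hh⟩ := hRr ((1 - S.P) y)
    refine ⟨h, ?_⟩
    have h1 := (hK ⟨_, h⟩).symm.trans hh
    simp only [hPR, sub_zero, smul_zero, add_zero] at h1
    exact h1
  · intro hEβ
    have hβ := S.β_pos
    refine ContinuousLinearMap.opNorm_le_bound _ (by positivity) fun y => ?_
    refine (hRn _).trans ?_
    have h1 : ‖(1 - S.P) y‖ ≤ ‖y‖ := by
      refine le_of_sq_le_sq ?_ (norm_nonneg _)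
      rw [hnorm y, hQ]
      nlinarith [sq_nonneg ‖S.P y‖]
    have h2 : δ⁻¹ ≤ β⁻¹ := inv_anti₀ hβ (by linarith)
    exact mul_le_mul h2 h1 (norm_nonneg _) (by positivity)
end
end

section
/- For every E ∈ [0, 2β), the operator H − E is invertible if and only if the Feshbach–Schur operator S(E) := Π(H − E)Π − ΠHΠ⊥R⊥(E)Π⊥HΠ is invertible in 𝓛(Πℋ); and in that case Π(H − E)⁻¹Π, viewed as an operator on the subspace Πℋ, equals S(E)⁻¹. -/
noncomputable section

open MeasureTheory
open scoped ComplexOrder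

section helpers
variable {ℋ : Type*} [NormedAddCommGroup ℋ] [InnerProductSpace ℂ ℋ] [CompleteSpace ℋ]
variable {β : ℝ} (S : FeshbachSetup ℋ β)

/-- graph of `H - E` -/
def FKr (E : ℝ) (u y : ℋ) : Prop := ∃ h : u ∈ S.H.domain, S.H ⟨u, h⟩ - (E : ℂ) • u = y

theorem FKr.add {E : ℝ} {u y u' y' : ℋ} (h : FKr S E u y) (h' : FKr S E u' y') :
    FKr S E (u + u') (y + y') := by
  obtain ⟨h, rfl⟩ := h
  obtain ⟨h', rfl⟩ := h'
  refine ⟨S.H.domain.add_mem h h', ?_⟩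
  have := S.H.map_add ⟨u, h⟩ ⟨u', h'⟩
  rw [AddMemClass.mk_add_mk] at this
  rw [this, smul_add]; abel

theorem FKr.sub {E : ℝ} {u y u' y' : ℋ} (h : FKr S E u y) (h' : FKr S E u' y') :
    FKr S E (u - u') (y - y') := by
  obtain ⟨h, rfl⟩ := h
  obtain ⟨h', rfl⟩ := h'
  refine ⟨S.H.domain.sub_mem h h', ?_⟩
  have := S.H.map_sub ⟨u, h⟩ ⟨u', h'⟩
  have e : (⟨u, h⟩ - ⟨u', h'⟩ : S.H.domain) = ⟨u - u', S.H.domain.sub_mem h h'⟩ := rfl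
  rw [e] at this
  rw [this, smul_sub]; abel

theorem FKr.uniq {E : ℝ} {u y y' : ℋ} (h : FKr S E u y) (h' : FKr S E u y') : y = y' := by
  obtain ⟨h, rfl⟩ := h
  obtain ⟨h', rfl⟩ := h'
  rfl

theorem FS_PP (x : ℋ) : S.P (S.P x) = S.P x := DFunLike.congr_fun S.P_idem x

theorem FS_TP (x : ℋ) : S.T (S.P x) = S.T x := by
  rw [S.T_eq, S.T_eq]; congr 1; ext; exact FS_PP S x

theorem FKr.P (E : ℝ) (x : ℋ) : FKr S E (S.P x) (S.T x - (E : ℂ) • S.P x) :=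
  ⟨S.memP x, by rw [S.T_eq]⟩

theorem FS_A (x : ℋ) : S.A x = S.T x - S.P (S.T x) := by
  simp [FeshbachSetup.A]

theorem FS_Psym (x y : ℋ) : inner ℂ (S.P x) y = inner ℂ x (S.P y) := by
  conv_rhs => rw [← S.P_sa]
  rw [ContinuousLinearMap.adjoint_inner_right]

theorem FS_Hsym (u v : S.H.domain) : inner ℂ (S.H u) (v : ℋ) = inner ℂ (u : ℋ) (S.H v) := by
  have h := LinearPMap.adjoint_isFormalAdjoint S.dense_dom
  have e : S.H.adjoint = S.H := S.selfAdjoint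
  rw [e] at h
  exact h u v

theorem FS_Aadj (v : ℋ) (hv : v ∈ S.H.domain) (hP : S.P v = 0) :
    ContinuousLinearMap.adjoint S.A v = S.P (S.H ⟨v, hv⟩) := by
  refine ext_inner_left ℂ fun x => ?_
  rw [ContinuousLinearMap.adjoint_inner_right, FS_A, inner_sub_left, FS_Psym, hP, inner_zero_right,
    sub_zero, S.T_eq, ← FS_Psym]
  exact FS_Hsym S ⟨S.P x, S.memP x⟩ ⟨v, hv⟩

theorem FS_AP (x : ℋ) : S.A (S.P x) = S.A x := by rw [FS_A, FS_A, FS_TP]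

theorem FS_PAadj (v : ℋ) : S.P (ContinuousLinearMap.adjoint S.A v) =
    ContinuousLinearMap.adjoint S.A v := by
  refine ext_inner_left ℂ fun x => ?_
  rw [← FS_Psym, ContinuousLinearMap.adjoint_inner_right, ContinuousLinearMap.adjoint_inner_right,
    FS_AP]

variable (R : ℝ → (ℋ →L[ℂ] ℋ)) (hR : S.IsRedResolvent R) (E : ℝ) (hE : E ∈ Set.Ico (0 : ℝ) (2 * β))
include hR hE

theorem FS_PR (y : ℋ) : S.P (R E y) = 0 := by
  rw [← (hR E hE).1]
  simp [FS_PP]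

theorem FS_RP (y : ℋ) : R E (S.P y) = 0 := by
  rw [← (hR E hE).1]
  simp [FS_PP]

theorem FKr_R (y : ℋ) :
    FKr S E (R E y) (y - S.P y + ContinuousLinearMap.adjoint S.A (R E y)) := by
  obtain ⟨h, e⟩ := (hR E hE).2.2 y
  refine ⟨h, ?_⟩
  have hp := FS_PR S R hR E hE y
  rw [FS_Aadj S _ h hp]
  simp only [_root_.sub_apply, one_apply_eq_self, map_sub, map_smul,
    hp, smul_zero, sub_zero] at e
  rw [← e]; abel

/-- the Schur operator -/
def FSW (R : ℝ → (ℋ →L[ℂ] ℋ)) (E : ℝ) : ℋ →L[ℂ] ℋ :=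
  S.P.comp S.T - (E : ℂ) • S.P - (ContinuousLinearMap.adjoint S.A).comp ((R E).comp S.A)

omit hR hE in
theorem FSW_apply (x : ℋ) : FSW S R E x = S.P (S.T x) - (E : ℂ) • S.P x
    - ContinuousLinearMap.adjoint S.A (R E (S.A x)) := rfl

theorem FKr.L (x : ℋ) : FKr S E (S.P x - R E (S.A x)) (FSW S R E x) := by
  have := (FKr.P S E x).sub S (FKr_R S R hR E hE (S.A x))
  convert this using 1
  rw [FSW_apply]
  have : S.P (S.A x) = 0 := by rw [FS_A, map_sub, FS_PP, sub_self]
  rw [this, FS_A]; abel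

theorem FKr.eqL {u y : ℋ} (h : FKr S E u y) (hy : S.P y = y) : u = S.P u - R E (S.A u) := by
  obtain ⟨hu, rfl⟩ := h
  have e := (hR E hE).2.1 ⟨u, hu⟩
  have hk := FKr.sub S (E := E) ⟨hu, rfl⟩ (FKr.P S E u)
  obtain ⟨h1, h2⟩ := hk
  simp only at e
  rw [h2] at e
  have : (1 - S.P) (S.H ⟨u, hu⟩ - (E : ℂ) • u - (S.T u - (E : ℂ) • S.P u)) = - S.A u := by
    rw [map_sub]
    simp only [_root_.sub_apply, one_apply_eq_self]
    rw [hy, FS_A]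
    simp only [map_sub, map_smul, FS_PP]
    abel
  rw [this, map_neg] at e
  rw [sub_eq_add_neg, e]; abel

omit hR hE in
theorem FSW_P (x : ℋ) : FSW S R E (S.P x) = FSW S R E x := by
  simp only [FSW_apply, FS_TP, FS_PP, FS_AP]

omit hR hE in
theorem P_FSW (x : ℋ) : S.P (FSW S R E x) = FSW S R E x := by
  simp only [FSW_apply, map_sub, map_smul, FS_PP, FS_PAadj]

theorem FS_forward {Rf : ℋ →L[ℂ] ℋ} (h : S.IsInvWitness E Rf) :
    IsCornerInv S.P (FSW S R E) (S.P.comp (Rf.comp S.P)) := by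
  refine ⟨?_, ?_, ?_⟩
  · ext x; simp [FS_PP]
  · ext x
    obtain ⟨h1, h2⟩ := FKr.L S R hR E hE x
    have h3 := h.1 ⟨_, h1⟩
    simp only at h3
    rw [h2] at h3
    simp [P_FSW, h3, FS_PP, FS_PR S R hR E hE]
  · ext x
    have hk : FKr S E (Rf (S.P x)) (S.P x) := h.2 (S.P x)
    have hl := FKr.eqL S R hR E hE hk (FS_PP S x)
    have h2 := FKr.L S R hR E hE (Rf (S.P x))
    rw [← hl] at h2
    simp only [ContinuousLinearMap.comp_apply, FSW_P]
    exact h2.uniq S hk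

theorem FS_backward {V : ℋ →L[ℂ] ℋ} (h : IsCornerInv S.P (FSW S R E) V) :
    S.IsInvertibleAt E := by
  obtain ⟨-, h2, h3⟩ := h
  have inj : ∀ u, FKr S E u 0 → u = 0 := by
    intro u hu
    have hl := FKr.eqL S R hR E hE hu (map_zero _)
    have h4 := FKr.L S R hR E hE u
    rw [← hl] at h4
    have hW := h4.uniq S hu
    have hP : S.P u = 0 := by
      rw [← h2, ContinuousLinearMap.comp_apply, hW, map_zero]
    rw [hl, ← FS_AP, hP]; simp
  let B : ℋ →L[ℂ] ℋ := S.P - (ContinuousLinearMap.adjoint S.A).comp (R E)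
  let Rf : ℋ →L[ℂ] ℋ := R E + (S.P - (R E).comp S.A).comp (V.comp B)
  have sol : ∀ y, FKr S E (Rf y) y := by
    intro y
    have := (FKr_R S R hR E hE y).add S (FKr.L S R hR E hE (V (B y)))
    convert this using 1
    · rfl
    have : FSW S R E (V (B y)) = S.P (B y) := by rw [← h3]; rfl
    rw [this]
    simp only [B, _root_.sub_apply, ContinuousLinearMap.comp_apply, map_sub, FS_PP,
      FS_PAadj]
    abel
  refine ⟨Rf, fun u => ?_, sol⟩
  have hu : FKr S E (u : ℋ) (S.H u - (E : ℂ) • (u : ℋ)) := ⟨u.2, rfl⟩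
  have := (sol (S.H u - (E : ℂ) • (u : ℋ))).sub S hu
  rw [sub_self] at this
  exact sub_eq_zero.1 (inj _ this)

end helpers

/-- Feshbach–Schur: for `E ∈ [0, 2β)`, `H - E` is invertible iff the operator
`S(E) = Π(H-E)Π - ΠHΠ⊥R⊥(E)Π⊥HΠ` is invertible in `𝓛(Πℋ)`; in that case
`Π(H-E)⁻¹Π`, viewed as an operator on `Πℋ`, equals `S(E)⁻¹`. -/
theorem feshbach_schur {ℋ : Type*} [NormedAddCommGroup ℋ] [InnerProductSpace ℂ ℋ]
    [CompleteSpace ℋ] {β : ℝ} (S : FeshbachSetup ℋ β)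
    (R : ℝ → (ℋ →L[ℂ] ℋ)) (hR : S.IsRedResolvent R) :
    ∀ E ∈ Set.Ico (0 : ℝ) (2 * β),
      (S.IsInvertibleAt E ↔ ∃ V, IsCornerInv S.P
          (S.P.comp S.T - (E : ℂ) • S.P
            - (ContinuousLinearMap.adjoint S.A).comp ((R E).comp S.A)) V) ∧
      (∀ Rfull V : ℋ →L[ℂ] ℋ, S.IsInvWitness E Rfull →
        IsCornerInv S.P
          (S.P.comp S.T - (E : ℂ) • S.P
            - (ContinuousLinearMap.adjoint S.A).comp ((R E).comp S.A)) V →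
        S.P.comp (Rfull.comp S.P) = V) := by
  intro E hE
  refine ⟨⟨fun ⟨Rf, h⟩ => ⟨_, FS_forward S R hR E hE h⟩,
    fun ⟨V, h⟩ => FS_backward S R hR E hE h⟩, fun Rf V h hV => ?_⟩
  obtain ⟨a1, a2, a3⟩ := FS_forward S R hR E hE h
  obtain ⟨b1, b2, b3⟩ := hV
  have b3' : (FSW S R E).comp V = S.P := b3
  have e1 : (S.P.comp (Rf.comp S.P)).comp S.P = V := by
    have e2 : (S.P.comp (Rf.comp S.P)).comp ((FSW S R E).comp V) = V := by
      rw [← ContinuousLinearMap.comp_assoc, a2, ← b1, ← ContinuousLinearMap.comp_assoc, S.P_idem]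
    rwa [b3'] at e2
  rw [← e1]
  ext x
  simp [FS_PP]
end
end
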